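/- arXiv:math/0510169 — 4 statements merged into one kernel-verified Lean document; each statement's English description precedes it below -/
import Mathlib

section
/- Let k be a commutative ring and λ ∈ k. Then there exists a free Rota–Baxter algebra of weight λ on one idempotent generator with a quasi-idempotent operator: a non-unital associative k-algebra F, a k-linear map β : F → F satisfying β(a)β(b) = β(β(a)b + aβ(b) + λab) for all a,b ∈ F and β∘β = −λ·β, and an element x ∈ F with x·x = x, such that for every non-unital associative k-algebra A, every k-linear map γ : A → A satisfying γ(a)γ(b) = γ(γ(a)b + aγ(b) + λab) for all a,b ∈ A and γ∘γ = −λ·γ, and every y ∈ A with y·y = y, there exists a unique non-unital k-algebra homomorphism f : F → A with f(x) = y and f∘β = γ∘f. -/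
/-- Data of a free Rota–Baxter algebra of weight `lam` on one idempotent generator and
with a quasi-idempotent operator, over the commutative ring `k`: a non-unital associative
`k`-algebra `F`, a `k`-linear Rota–Baxter operator `β` of weight `lam` on `F` with
`β ∘ β = -lam • β`, and an idempotent element `x` of `F`, which is initial among all
such triples: for every non-unital associative `k`-algebra `A` with a `k`-linear
Rota–Baxter operator `γ` of weight `lam` satisfying `γ ∘ γ = -lam • γ` and every
idempotent `y ∈ A` there is a unique non-unital `k`-algebra homomorphism `f : F → A`
with `f x = y` commuting with the Rota–Baxter operators. -/
structure FreeQuasiIdemRotaBaxterAlgebra (k : Type) [CommRing k] (lam : k) where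
  F : Type
  [ringF : NonUnitalRing F]
  [moduleF : Module k F]
  [smulCommF : SMulCommClass k F F]
  [towerF : IsScalarTower k F F]
  β : F →ₗ[k] F
  x : F
  baxter : ∀ a b : F, β a * β b = β (β a * b + a * β b + lam • (a * b))
  quasiIdem : ∀ a : F, β (β a) = -lam • β a
  idemGen : x * x = x
  universal : ∀ (A : Type) [NonUnitalRing A] [Module k A] [SMulCommClass k A A]
    [IsScalarTower k A A] (γ : A →ₗ[k] A),
    (∀ a b : A, γ a * γ b = γ (γ a * b + a * γ b + lam • (a * b))) →
    (∀ a : A, γ (γ a) = -lam • γ a) →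
    ∀ y : A, y * y = y →
      ∃! f : F →ₙₐ[k] A, f x = y ∧ ∀ a : F, f (β a) = γ (f a)

/-- Formal expressions in one generator `x`, the operations of a non-unital `k`-algebra and a
unary operator `beta`. -/
inductive RotaBaxterTerm (k : Type) : Type
  | x : RotaBaxterTerm k
  | zero : RotaBaxterTerm k
  | add : RotaBaxterTerm k → RotaBaxterTerm k → RotaBaxterTerm k
  | neg : RotaBaxterTerm k → RotaBaxterTerm k
  | mul : RotaBaxterTerm k → RotaBaxterTerm k → RotaBaxterTerm k
  | smul : k → RotaBaxterTerm k → RotaBaxterTerm k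
  | beta : RotaBaxterTerm k → RotaBaxterTerm k

namespace RotaBaxterTerm

variable {k : Type} [CommRing k] (lam : k)

/-- The congruence generated by the axioms of a Rota–Baxter algebra of weight `lam` with
quasi-idempotent operator and idempotent generator. -/
inductive Rel : RotaBaxterTerm k → RotaBaxterTerm k → Prop
  | refl (a) : Rel a a
  | symm {a b} : Rel a b → Rel b a
  | trans {a b c} : Rel a b → Rel b c → Rel a c
  | add_congr {a a' b b'} : Rel a a' → Rel b b' → Rel (add a b) (add a' b')
  | neg_congr {a a'} : Rel a a' → Rel (neg a) (neg a')
  | mul_congr {a a' b b'} : Rel a a' → Rel b b' → Rel (mul a b) (mul a' b')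
  | smul_congr (c : k) {a a'} : Rel a a' → Rel (smul c a) (smul c a')
  | beta_congr {a a'} : Rel a a' → Rel (beta a) (beta a')
  | add_assoc (a b c) : Rel (add (add a b) c) (add a (add b c))
  | add_comm (a b) : Rel (add a b) (add b a)
  | zero_add (a) : Rel (add zero a) a
  | neg_add_cancel (a) : Rel (add (neg a) a) zero
  | mul_assoc (a b c) : Rel (mul (mul a b) c) (mul a (mul b c))
  | left_distrib (a b c) : Rel (mul a (add b c)) (add (mul a b) (mul a c))
  | right_distrib (a b c) : Rel (mul (add a b) c) (add (mul a c) (mul b c))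
  | one_smul (a) : Rel (smul 1 a) a
  | mul_smul (c d : k) (a) : Rel (smul (c * d) a) (smul c (smul d a))
  | smul_add (c : k) (a b) : Rel (smul c (add a b)) (add (smul c a) (smul c b))
  | add_smul (c d : k) (a) : Rel (smul (c + d) a) (add (smul c a) (smul d a))
  | smul_mul (c : k) (a b) : Rel (mul (smul c a) b) (smul c (mul a b))
  | mul_smul_comm (c : k) (a b) : Rel (mul a (smul c b)) (smul c (mul a b))
  | beta_add (a b) : Rel (beta (add a b)) (add (beta a) (beta b))
  | beta_smul (c : k) (a) : Rel (beta (smul c a)) (smul c (beta a))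
  | baxter (a b) : Rel (mul (beta a) (beta b))
      (beta (add (add (mul (beta a) b) (mul a (beta b))) (smul lam (mul a b))))
  | quasiIdem (a) : Rel (beta (beta a)) (smul (-lam) (beta a))
  | idemGen : Rel (mul x x) x

/-- The setoid of the congruence `Rel lam`. -/
def setoid : Setoid (RotaBaxterTerm k) :=
  ⟨Rel lam, Rel.refl, Rel.symm, Rel.trans⟩

/-- Evaluation of a formal expression at an element `y` of an algebra with operator `γ`. -/
def eval {A : Type} [NonUnitalRing A] [Module k A] (γ : A →ₗ[k] A) (y : A) :
    RotaBaxterTerm k → A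
  | x => y
  | zero => 0
  | add a b => eval γ y a + eval γ y b
  | neg a => -eval γ y a
  | mul a b => eval γ y a * eval γ y b
  | smul c a => c • eval γ y a
  | beta a => γ (eval γ y a)

theorem eval_eq_of_rel {A : Type} [NonUnitalRing A] [Module k A] [SMulCommClass k A A]
    [IsScalarTower k A A] (γ : A →ₗ[k] A)
    (hγ : ∀ a b : A, γ a * γ b = γ (γ a * b + a * γ b + lam • (a * b)))
    (hγ' : ∀ a : A, γ (γ a) = -lam • γ a) (y : A) (hy : y * y = y)
    {a b : RotaBaxterTerm k} (h : Rel lam a b) : eval γ y a = eval γ y b := by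
  induction h with
  | refl => rfl
  | symm _ ih => exact ih.symm
  | trans _ _ ih₁ ih₂ => exact ih₁.trans ih₂
  | add_congr _ _ ih₁ ih₂ => simp only [eval, ih₁, ih₂]
  | neg_congr _ ih => simp only [eval, ih]
  | mul_congr _ _ ih₁ ih₂ => simp only [eval, ih₁, ih₂]
  | smul_congr _ _ ih => simp only [eval, ih]
  | beta_congr _ ih => simp only [eval, ih]
  | add_assoc => exact _root_.add_assoc _ _ _
  | add_comm => exact _root_.add_comm _ _
  | zero_add => exact _root_.zero_add _
  | neg_add_cancel => exact _root_.neg_add_cancel _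
  | mul_assoc => exact _root_.mul_assoc _ _ _
  | left_distrib => exact mul_add _ _ _
  | right_distrib => exact add_mul _ _ _
  | one_smul => exact _root_.one_smul _ _
  | mul_smul => exact SemigroupAction.mul_smul _ _ _
  | smul_add => exact _root_.smul_add _ _ _
  | add_smul => exact _root_.add_smul _ _ _
  | smul_mul => exact smul_mul_assoc _ _ _
  | mul_smul_comm => exact _root_.mul_smul_comm _ _ _
  | beta_add => exact map_add γ _ _
  | beta_smul => exact map_smul γ _ _
  | baxter => exact hγ _ _
  | quasiIdem => exact hγ' _
  | idemGen => exact hy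

end RotaBaxterTerm

/-- Formal expressions modulo the axioms: the carrier of the free algebra. -/
def FreeRotaBaxterQuotient {k : Type} [CommRing k] (lam : k) : Type :=
  Quotient (RotaBaxterTerm.setoid lam)

namespace FreeRotaBaxterQuotient

open RotaBaxterTerm

variable {k : Type} [CommRing k] (lam : k)

/-- The class of a formal expression. -/
def mk (a : RotaBaxterTerm k) : FreeRotaBaxterQuotient lam :=
  Quotient.mk (setoid lam) a

variable {lam}

theorem sound {a b : RotaBaxterTerm k} (h : Rel lam a b) : mk lam a = mk lam b :=
  Quotient.sound (s := setoid lam) h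

theorem ind {p : FreeRotaBaxterQuotient lam → Prop} (h : ∀ a, p (mk lam a)) (a) : p a :=
  Quotient.inductionOn a h

instance : Zero (FreeRotaBaxterQuotient lam) := ⟨mk lam zero⟩

instance : Add (FreeRotaBaxterQuotient lam) :=
  ⟨Quotient.map₂ add fun _ _ h₁ _ _ h₂ => Rel.add_congr h₁ h₂⟩

instance : Neg (FreeRotaBaxterQuotient lam) :=
  ⟨Quotient.map neg fun _ _ h => Rel.neg_congr h⟩

instance : Mul (FreeRotaBaxterQuotient lam) :=
  ⟨Quotient.map₂ mul fun _ _ h₁ _ _ h₂ => Rel.mul_congr h₁ h₂⟩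

instance : SMul k (FreeRotaBaxterQuotient lam) :=
  ⟨fun c => Quotient.map (smul c) fun _ _ h => Rel.smul_congr c h⟩

instance : AddCommGroup (FreeRotaBaxterQuotient lam) :=
  { AddGroup.ofLeftAxioms
      (ind fun a => ind fun b => ind fun c => sound (Rel.add_assoc a b c))
      (ind fun a => sound (Rel.zero_add a))
      (ind fun a => sound (Rel.neg_add_cancel a)) with
    add_comm := ind fun a => ind fun b => sound (Rel.add_comm a b) }

instance : NonUnitalRing (FreeRotaBaxterQuotient lam) :=
  have left_distrib : ∀ a b c : FreeRotaBaxterQuotient lam, a * (b + c) = a * b + a * c :=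
    ind fun a => ind fun b => ind fun c => sound (Rel.left_distrib a b c)
  have right_distrib : ∀ a b c : FreeRotaBaxterQuotient lam, (a + b) * c = a * c + b * c :=
    ind fun a => ind fun b => ind fun c => sound (Rel.right_distrib a b c)
  { (inferInstance : AddCommGroup (FreeRotaBaxterQuotient lam)) with
    left_distrib := left_distrib
    right_distrib := right_distrib
    zero_mul := fun a => by
      have h := right_distrib 0 0 a
      rwa [add_zero, left_eq_add] at h
    mul_zero := fun a => by
      have h := left_distrib a 0 0
      rwa [add_zero, left_eq_add] at h
    mul_assoc := ind fun a => ind fun b => ind fun c => sound (Rel.mul_assoc a b c) }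

instance : Module k (FreeRotaBaxterQuotient lam) :=
  Module.ofMinimalAxioms
    (fun c => ind fun a => ind fun b => sound (Rel.smul_add c a b))
    (fun c d => ind fun a => sound (Rel.add_smul c d a))
    (fun c d => ind fun a => sound (Rel.mul_smul c d a))
    (ind fun a => sound (Rel.one_smul a))

instance : SMulCommClass k (FreeRotaBaxterQuotient lam) (FreeRotaBaxterQuotient lam) :=
  ⟨fun c => ind fun a => ind fun b => (sound (Rel.mul_smul_comm c a b)).symm⟩

instance : IsScalarTower k (FreeRotaBaxterQuotient lam) (FreeRotaBaxterQuotient lam) :=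
  ⟨fun c => ind fun a => ind fun b => sound (Rel.smul_mul c a b)⟩

/-- The operator on the quotient induced by `beta`. -/
def operator : FreeRotaBaxterQuotient lam →ₗ[k] FreeRotaBaxterQuotient lam where
  toFun := Quotient.map beta fun _ _ h => Rel.beta_congr h
  map_add' := ind fun a => ind fun b => sound (Rel.beta_add a b)
  map_smul' := fun c => ind fun a => sound (Rel.beta_smul c a)

/-- The homomorphism induced by evaluation. -/
def lift {A : Type} [NonUnitalRing A] [Module k A] [SMulCommClass k A A]
    [IsScalarTower k A A] (γ : A →ₗ[k] A)
    (hγ : ∀ a b : A, γ a * γ b = γ (γ a * b + a * γ b + lam • (a * b)))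
    (hγ' : ∀ a : A, γ (γ a) = -lam • γ a) (y : A) (hy : y * y = y) :
    FreeRotaBaxterQuotient lam →ₙₐ[k] A where
  toFun := Quotient.lift (eval γ y) fun _ _ h => eval_eq_of_rel lam γ hγ hγ' y hy h
  map_smul' := fun _ => ind fun _ => rfl
  map_zero' := rfl
  map_add' := ind fun _ => ind fun _ => rfl
  map_mul' := ind fun _ => ind fun _ => rfl

theorem apply_mk_eq_eval {A : Type} [NonUnitalRing A] [Module k A] (γ : A →ₗ[k] A)
    (f : FreeRotaBaxterQuotient lam →ₙₐ[k] A) (hf : ∀ a, f (operator a) = γ (f a))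
    (a : RotaBaxterTerm k) : f (mk lam a) = eval γ (f (mk lam x)) a := by
  induction a with
  | x => rfl
  | zero => exact map_zero f
  | add a b iha ihb => exact (map_add f (mk lam a) (mk lam b)).trans (by rw [iha, ihb]; rfl)
  | neg a ih => exact (map_neg f (mk lam a)).trans (by rw [ih]; rfl)
  | mul a b iha ihb => exact (map_mul f (mk lam a) (mk lam b)).trans (by rw [iha, ihb]; rfl)
  | smul c a ih => exact (map_smul f c (mk lam a)).trans (by rw [ih]; rfl)
  | beta a ih => exact (hf (mk lam a)).trans (by rw [ih]; rfl)

end FreeRotaBaxterQuotient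

/-- the free Rota–Baxter algebra of weight `lam` on one idempotent
generator with a quasi-idempotent operator exists. -/
theorem statement15 (k : Type) [CommRing k] (lam : k) :
    Nonempty (FreeQuasiIdemRotaBaxterAlgebra k lam) := by
  open FreeRotaBaxterQuotient RotaBaxterTerm in
  exact ⟨{
    F := FreeRotaBaxterQuotient lam
    β := operator
    x := mk lam x
    baxter := ind fun a => ind fun b => sound (Rel.baxter a b)
    quasiIdem := ind fun a => sound (Rel.quasiIdem a)
    idemGen := sound Rel.idemGen
    universal := fun A _ _ _ _ γ hγ hγ' y hy =>
      ⟨lift γ hγ hγ' y hy, ⟨rfl, ind fun _ => rfl⟩, fun f hf =>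
        NonUnitalAlgHom.ext (ind fun a => by
          rw [apply_mk_eq_eval γ f hf.2 a, hf.1]; rfl)⟩ }⟩
end

section
/- Let k be a commutative ring, let M = k⟨x₀,x₁⟩ be the free unital associative k-algebra on two generators x₀, x₁, and let β : M → M be the unique unital k-algebra endomorphism with β(x₀) = x₁ and β(x₁) = x₁. Then β∘β = β, and (M, x₀, β) is the free unital algebra on one generator with an idempotent endomorphism: for every unital associative k-algebra A, every element x ∈ A, and every unital k-algebra endomorphism γ : A → A with γ∘γ = γ, there exists a unique unital k-algebra homomorphism φ : M → A such that φ(x₀) = x and φ∘β = γ∘φ. -/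
/-- let `M = k⟨x₀,x₁⟩` be the free unital associative algebra on two
generators and `β` the unique unital algebra endomorphism with `β x₀ = x₁` and
`β x₁ = x₁`. Then `β` is idempotent, and `(M, x₀, β)` is the free unital algebra on one
generator with an idempotent endomorphism. -/
theorem statement16 (k : Type) [CommRing k]
    (β : FreeAlgebra k (Fin 2) →ₐ[k] FreeAlgebra k (Fin 2))
    (h0 : β (FreeAlgebra.ι k 0) = FreeAlgebra.ι k 1)
    (h1 : β (FreeAlgebra.ι k 1) = FreeAlgebra.ι k 1) :
    (∀ a : FreeAlgebra k (Fin 2), β (β a) = β a) ∧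
    ∀ (A : Type) [Ring A] [Algebra k A] (x : A) (γ : A →ₐ[k] A),
      (∀ a : A, γ (γ a) = γ a) →
      ∃! φ : FreeAlgebra k (Fin 2) →ₐ[k] A,
        φ (FreeAlgebra.ι k 0) = x ∧ ∀ a : FreeAlgebra k (Fin 2), φ (β a) = γ (φ a) := by
  refine ⟨fun a => ?_, fun A _ _ x γ hγ => ?_⟩
  · have h : β.comp β = β := by
      apply FreeAlgebra.hom_ext
      funext i
      fin_cases i
      · simp [h0, h1]
      · simp [h1]
    exact DFunLike.congr_fun h a
  · let φ : FreeAlgebra k (Fin 2) →ₐ[k] A := FreeAlgebra.lift k ![x, γ x]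
    have hφ0 : φ (FreeAlgebra.ι k 0) = x := by simp [φ]
    have hφ1 : φ (FreeAlgebra.ι k 1) = γ x := by simp [φ]
    have hφβ : φ.comp β = γ.comp φ := by
      apply FreeAlgebra.hom_ext
      funext i
      fin_cases i
      · simp [h0, hφ0, hφ1]
      · simp [h1, hφ1, hγ]
    refine ⟨φ, ⟨hφ0, fun a => DFunLike.congr_fun hφβ a⟩, ?_⟩
    rintro ψ ⟨hψ0, hψβ⟩
    have hψ1 : ψ (FreeAlgebra.ι k 1) = γ x := by rw [← h0, hψβ, hψ0]
    apply FreeAlgebra.hom_ext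
    funext i
    fin_cases i
    · simp [hψ0, hφ0]
    · simp [hψ1, hφ1]
end

section
/- Let k be a commutative ring, λ ∈ k, and (A, β) a Rota–Baxter algebra of weight λ, i.e., A is a (possibly non-unital) associative k-algebra and β : A → A is a k-linear map satisfying β(a)β(b) = β(β(a)b + aβ(b) + λab) for all a,b ∈ A. Define x ≻ y = β(x)y, x ≺ y = xβ(y), x · y = xy, and x ∗ y = x ≺ y + x ≻ y + λ(x·y). Then (A, ≺, ≻, ·) is a λ-dendriform trialgebra: for all x, y, z ∈ A, (x∗y) ≻ z = x ≻ (y ≻ z); (x ≻ y) ≺ z = x ≻ (y ≺ z); (x ≺ y) ≺ z = x ≺ (y∗z); (x ≻ y)·z = x ≻ (y·z); (x ≺ y)·z = x·(y ≻ z); (x·y) ≺ z = x·(y ≺ z); and (x·y)·z = x·(y·z). -/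
/-- a Rota–Baxter algebra `(A, β)` of weight `lam` becomes a
`lam`-dendriform trialgebra under `x ≻ y = β x * y`, `x ≺ y = x * β y`, `x · y = x * y`,
with `x ∗ y = x ≺ y + x ≻ y + lam • (x · y)`: the seven dendriform trialgebra
identities hold. -/
theorem statement18 (k A : Type) [CommRing k] [NonUnitalRing A] [Module k A]
    [SMulCommClass k A A] [IsScalarTower k A A]
    (lam : k) (β : A →ₗ[k] A)
    (hβ : ∀ a b : A, β a * β b = β (β a * b + a * β b + lam • (a * b))) :
    ∀ x y z : A,
      -- (x∗y) ≻ z = x ≻ (y ≻ z)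
      (β (x * β y + β x * y + lam • (x * y)) * z = β x * (β y * z)) ∧
      -- (x ≻ y) ≺ z = x ≻ (y ≺ z)
      ((β x * y) * β z = β x * (y * β z)) ∧
      -- (x ≺ y) ≺ z = x ≺ (y∗z)
      ((x * β y) * β z = x * β (y * β z + β y * z + lam • (y * z))) ∧
      -- (x ≻ y) · z = x ≻ (y · z)
      ((β x * y) * z = β x * (y * z)) ∧
      -- (x ≺ y) · z = x · (y ≻ z)
      ((x * β y) * z = x * (β y * z)) ∧
      -- (x · y) ≺ z = x · (y ≺ z)
      ((x * y) * β z = x * (y * β z)) ∧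
      -- (x · y) · z = x · (y · z)
      ((x * y) * z = x * (y * z)) := by
  intro x y z
  have hstar (a b : A) : β (a * β b + β a * b + lam • (a * b)) = β a * β b := by
    rw [hβ, add_comm (a * β b)]
  refine ⟨?_, mul_assoc _ _ _, ?_, mul_assoc _ _ _, mul_assoc _ _ _, mul_assoc _ _ _,
    mul_assoc _ _ _⟩
  · rw [hstar, mul_assoc]
  · rw [hstar, mul_assoc]
end

section
/- Let k be a commutative ring and λ ∈ k. Then there exists a free Rota–Baxter algebra of weight λ on one generator: a non-unital associative k-algebra F, a k-linear map β : F → F satisfying β(a)β(b) = β(β(a)b + aβ(b) + λab) for all a,b ∈ F, and an element x ∈ F, such that for every non-unital associative k-algebra A, every k-linear map γ : A → A satisfying γ(a)γ(b) = γ(γ(a)b + aγ(b) + λab) for all a,b ∈ A, and every y ∈ A, there exists a unique non-unital k-algebra homomorphism f : F → A with f(x) = y and f∘β = γ∘f. -/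
/-- Data of a free Rota–Baxter algebra of weight `lam` on one generator over `k`:
a non-unital associative `k`-algebra `F`, a `k`-linear Rota–Baxter operator `β` of
weight `lam` on `F`, and an element `x` of `F`, such that for every non-unital
associative `k`-algebra `A` with a `k`-linear Rota–Baxter operator `γ` of weight `lam`
and every `y ∈ A` there is a unique non-unital `k`-algebra homomorphism `f : F → A` with
`f x = y` commuting with the Rota–Baxter operators. -/
structure FreeRotaBaxterAlgebra (k : Type) [CommRing k] (lam : k) where
  F : Type
  [ringF : NonUnitalRing F]
  [moduleF : Module k F]
  [smulCommF : SMulCommClass k F F]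
  [towerF : IsScalarTower k F F]
  β : F →ₗ[k] F
  x : F
  baxter : ∀ a b : F, β a * β b = β (β a * b + a * β b + lam • (a * b))
  universal : ∀ (A : Type) [NonUnitalRing A] [Module k A] [SMulCommClass k A A]
    [IsScalarTower k A A] (γ : A →ₗ[k] A),
    (∀ a b : A, γ a * γ b = γ (γ a * b + a * γ b + lam • (a * b))) →
    ∀ y : A, ∃! f : F →ₙₐ[k] A, f x = y ∧ ∀ a : F, f (β a) = γ (f a)

namespace FreeRotaBaxterAlgebra

/-- Formal expressions in one variable built from the operations of a Rota–Baxter algebra. -/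
inductive Pre (k : Type) : Type
  | var : Pre k
  | zero : Pre k
  | add : Pre k → Pre k → Pre k
  | mul : Pre k → Pre k → Pre k
  | smul : k → Pre k → Pre k
  | op : Pre k → Pre k

namespace Pre

variable {k : Type} [CommRing k]

/-- The Rota–Baxter algebra axioms, closed under the operations. -/
inductive Rel (lam : k) : Pre k → Pre k → Prop
  | add_left {a a' : Pre k} (b : Pre k) : Rel lam a a' → Rel lam (add a b) (add a' b)
  | add_right (a : Pre k) {b b' : Pre k} : Rel lam b b' → Rel lam (add a b) (add a b')
  | mul_left {a a' : Pre k} (b : Pre k) : Rel lam a a' → Rel lam (mul a b) (mul a' b)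
  | mul_right (a : Pre k) {b b' : Pre k} : Rel lam b b' → Rel lam (mul a b) (mul a b')
  | smul_congr (c : k) {a a' : Pre k} : Rel lam a a' → Rel lam (smul c a) (smul c a')
  | op_congr {a a' : Pre k} : Rel lam a a' → Rel lam (op a) (op a')
  | add_assoc (a b c : Pre k) : Rel lam (add (add a b) c) (add a (add b c))
  | add_comm (a b : Pre k) : Rel lam (add a b) (add b a)
  | zero_add (a : Pre k) : Rel lam (add zero a) a
  | mul_assoc (a b c : Pre k) : Rel lam (mul (mul a b) c) (mul a (mul b c))
  | left_distrib (a b c : Pre k) : Rel lam (mul a (add b c)) (add (mul a b) (mul a c))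
  | right_distrib (a b c : Pre k) : Rel lam (mul (add a b) c) (add (mul a c) (mul b c))
  | one_smul (a : Pre k) : Rel lam (smul 1 a) a
  | mul_smul (r s : k) (a : Pre k) : Rel lam (smul (r * s) a) (smul r (smul s a))
  | smul_add (r : k) (a b : Pre k) : Rel lam (smul r (add a b)) (add (smul r a) (smul r b))
  | add_smul (r s : k) (a : Pre k) : Rel lam (smul (r + s) a) (add (smul r a) (smul s a))
  | zero_smul (a : Pre k) : Rel lam (smul 0 a) zero
  | smul_zero (r : k) : Rel lam (smul r zero) zero
  | smul_mul (r : k) (a b : Pre k) : Rel lam (mul (smul r a) b) (smul r (mul a b))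
  | mul_smul_right (r : k) (a b : Pre k) : Rel lam (mul a (smul r b)) (smul r (mul a b))
  | zero_mul (a : Pre k) : Rel lam (mul zero a) zero
  | mul_zero (a : Pre k) : Rel lam (mul a zero) zero
  | op_add (a b : Pre k) : Rel lam (op (add a b)) (add (op a) (op b))
  | op_smul (r : k) (a : Pre k) : Rel lam (op (smul r a)) (smul r (op a))
  | baxter (a b : Pre k) : Rel lam (mul (op a) (op b))
      (op (add (add (mul (op a) b) (mul a (op b))) (smul lam (mul a b))))

/-- Evaluation of a formal expression at an element `y` of an algebra with operator `γ`. -/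
def eval {A : Type} [NonUnitalRing A] [Module k A] (γ : A →ₗ[k] A) (y : A) : Pre k → A
  | var => y
  | zero => 0
  | add a b => eval γ y a + eval γ y b
  | mul a b => eval γ y a * eval γ y b
  | smul c a => c • eval γ y a
  | op a => γ (eval γ y a)

theorem eval_eq_of_rel {lam : k} {A : Type} [NonUnitalRing A] [Module k A] [SMulCommClass k A A]
    [IsScalarTower k A A] {γ : A →ₗ[k] A}
    (hγ : ∀ a b : A, γ a * γ b = γ (γ a * b + a * γ b + lam • (a * b))) (y : A)
    {a b : Pre k} (h : Rel lam a b) : eval γ y a = eval γ y b := by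
  induction h with
  | add_left _ _ ih | add_right _ _ ih | mul_left _ _ ih | mul_right _ _ ih
  | smul_congr _ _ ih | op_congr _ ih => simp only [eval, ih]
  | add_assoc => exact _root_.add_assoc _ _ _
  | add_comm => exact _root_.add_comm _ _
  | zero_add => exact _root_.zero_add _
  | mul_assoc => exact _root_.mul_assoc _ _ _
  | left_distrib => exact _root_.mul_add _ _ _
  | right_distrib => exact _root_.add_mul _ _ _
  | one_smul => exact _root_.one_smul _ _
  | mul_smul => exact SemigroupAction.mul_smul _ _ _
  | smul_add => exact _root_.smul_add _ _ _
  | add_smul => exact _root_.add_smul _ _ _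
  | zero_smul => exact _root_.zero_smul _ _
  | smul_zero => exact _root_.smul_zero _
  | smul_mul => exact smul_mul_assoc _ _ _
  | mul_smul_right => exact mul_smul_comm _ _ _
  | zero_mul => exact MulZeroClass.zero_mul _
  | mul_zero => exact MulZeroClass.mul_zero _
  | op_add => exact map_add γ _ _
  | op_smul => exact map_smul γ _ _
  | baxter => exact hγ _ _

end Pre

variable {k : Type} [CommRing k] (lam : k)

/-- The quotient of formal expressions by the Rota–Baxter algebra axioms. -/
def Carrier : Type := Quot (Pre.Rel lam)

namespace Carrier

/-- The class of a formal expression. -/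
def mk (p : Pre k) : Carrier lam := Quot.mk _ p

instance : Zero (Carrier lam) := ⟨Quot.mk _ .zero⟩

instance : Add (Carrier lam) :=
  ⟨Quot.map₂ Pre.add (fun a _ _ => .add_right a) (fun _ _ b => .add_left b)⟩

instance : Mul (Carrier lam) :=
  ⟨Quot.map₂ Pre.mul (fun a _ _ => .mul_right a) (fun _ _ b => .mul_left b)⟩

instance : SMul k (Carrier lam) :=
  ⟨fun c => Quot.map (Pre.smul c) fun _ _ => .smul_congr c⟩

instance : Neg (Carrier lam) := ⟨fun a => (-1 : k) • a⟩

theorem add_comm' (a b : Carrier lam) : a + b = b + a := by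
  induction a using Quot.ind; induction b using Quot.ind
  exact Quot.sound (.add_comm _ _)

theorem zero_add' (a : Carrier lam) : 0 + a = a := by
  induction a using Quot.ind
  exact Quot.sound (.zero_add _)

theorem one_smul' (a : Carrier lam) : (1 : k) • a = a := by
  induction a using Quot.ind
  exact Quot.sound (.one_smul _)

theorem add_smul' (r s : k) (a : Carrier lam) : (r + s) • a = r • a + s • a := by
  induction a using Quot.ind
  exact Quot.sound (.add_smul _ _ _)

theorem zero_smul' (a : Carrier lam) : (0 : k) • a = 0 := by
  induction a using Quot.ind
  exact Quot.sound (.zero_smul _)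

instance : NonUnitalRing (Carrier lam) where
  add_assoc a b c := by
    induction a using Quot.ind; induction b using Quot.ind; induction c using Quot.ind
    exact Quot.sound (.add_assoc _ _ _)
  zero_add := zero_add' lam
  add_zero a := by rw [add_comm', zero_add']
  add_comm := add_comm' lam
  nsmul := nsmulRec
  zsmul := zsmulRec
  neg_add_cancel a := by
    change (-1 : k) • a + a = 0
    nth_rw 2 [← one_smul' lam a]
    rw [← add_smul', neg_add_cancel, zero_smul']
  left_distrib a b c := by
    induction a using Quot.ind; induction b using Quot.ind; induction c using Quot.ind
    exact Quot.sound (.left_distrib _ _ _)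
  right_distrib a b c := by
    induction a using Quot.ind; induction b using Quot.ind; induction c using Quot.ind
    exact Quot.sound (.right_distrib _ _ _)
  zero_mul a := by
    induction a using Quot.ind
    exact Quot.sound (.zero_mul _)
  mul_zero a := by
    induction a using Quot.ind
    exact Quot.sound (.mul_zero _)
  mul_assoc a b c := by
    induction a using Quot.ind; induction b using Quot.ind; induction c using Quot.ind
    exact Quot.sound (.mul_assoc _ _ _)

instance : Module k (Carrier lam) where
  one_smul := one_smul' lam
  mul_smul r s a := by
    induction a using Quot.ind
    exact Quot.sound (.mul_smul _ _ _)
  smul_zero r := Quot.sound (.smul_zero r)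
  smul_add r a b := by
    induction a using Quot.ind; induction b using Quot.ind
    exact Quot.sound (.smul_add _ _ _)
  add_smul := add_smul' lam
  zero_smul := zero_smul' lam

instance : SMulCommClass k (Carrier lam) (Carrier lam) where
  smul_comm r a b := by
    induction a using Quot.ind; induction b using Quot.ind
    exact (Quot.sound (.mul_smul_right _ _ _)).symm

instance : IsScalarTower k (Carrier lam) (Carrier lam) where
  smul_assoc r a b := by
    induction a using Quot.ind; induction b using Quot.ind
    exact Quot.sound (.smul_mul _ _ _)

/-- The Rota–Baxter operator on the free Rota–Baxter algebra. -/
def op : Carrier lam →ₗ[k] Carrier lam where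
  toFun := Quot.map Pre.op fun _ _ => .op_congr
  map_add' a b := by
    induction a using Quot.ind; induction b using Quot.ind
    exact Quot.sound (.op_add _ _)
  map_smul' r a := by
    induction a using Quot.ind
    exact Quot.sound (.op_smul _ _)

theorem op_mul_op (a b : Carrier lam) :
    op lam a * op lam b = op lam (op lam a * b + a * op lam b + lam • (a * b)) := by
  induction a using Quot.ind; induction b using Quot.ind
  exact Quot.sound (.baxter _ _)

variable {lam} {A : Type} [NonUnitalRing A] [Module k A] {γ : A →ₗ[k] A}

/-- The homomorphism out of the free Rota–Baxter algebra sending the generator to `y`. -/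
def lift [SMulCommClass k A A] [IsScalarTower k A A]
    (hγ : ∀ a b : A, γ a * γ b = γ (γ a * b + a * γ b + lam • (a * b))) (y : A) :
    Carrier lam →ₙₐ[k] A where
  toFun := Quot.lift (Pre.eval γ y) fun _ _ => Pre.eval_eq_of_rel hγ y
  map_smul' r a := by
    induction a using Quot.ind
    rfl
  map_zero' := rfl
  map_add' a b := by
    induction a using Quot.ind; induction b using Quot.ind
    rfl
  map_mul' a b := by
    induction a using Quot.ind; induction b using Quot.ind
    rfl

theorem map_mk_eq_eval (f : Carrier lam →ₙₐ[k] A) (hf : ∀ a, f (op lam a) = γ (f a))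
    (p : Pre k) : f (mk lam p) = Pre.eval γ (f (mk lam .var)) p := by
  induction p with
  | var => rfl
  | zero => exact map_zero f
  | add a b iha ihb =>
    exact (map_add f (mk lam a) (mk lam b)).trans (congrArg₂ (· + ·) iha ihb)
  | mul a b iha ihb =>
    exact (map_mul f (mk lam a) (mk lam b)).trans (congrArg₂ (· * ·) iha ihb)
  | smul c a ih => exact (map_smul f c (mk lam a)).trans (congrArg (c • ·) ih)
  | op a ih => exact (hf (mk lam a)).trans (congrArg γ ih)

end Carrier

end FreeRotaBaxterAlgebra

/-- the free Rota–Baxter algebra of weight `lam` on one generator exists. -/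
theorem statement19 (k : Type) [CommRing k] (lam : k) :
    Nonempty (FreeRotaBaxterAlgebra k lam) := by
  open FreeRotaBaxterAlgebra in
  refine ⟨{
    F := Carrier lam
    β := Carrier.op lam
    x := Carrier.mk lam .var
    baxter := Carrier.op_mul_op lam
    universal := fun A _ _ _ _ γ hγ y => ⟨Carrier.lift hγ y, ⟨rfl, ?_⟩, ?_⟩ }⟩
  · rintro ⟨a⟩
    rfl
  · rintro f ⟨rfl, hf⟩
    ext ⟨p⟩
    exact Carrier.map_mk_eq_eval f hf p
end
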